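/- arXiv:1702.03873 — 2 statements merged into one kernel-verified Lean document; each statement's English description precedes it below -/
import Mathlib

section
/- The matrix A has rank N − 1; equivalently, the kernel of A (as a linear map ℝ^N → ℝ^N) is exactly the one-dimensional span of the all-ones vector. -/
open Matrix

/-- Matrix representation of the μ-derivative ∇^μ for the discrete measure
μ = Σᵢ αᵢ δ_{zᵢ}: `A i i = -(α i)⁻¹`, `A i (i+1 mod N) = (α i)⁻¹`, all other entries `0`. -/
noncomputable def matA (N : ℕ) [NeZero N] (α : Fin N → ℝ) : Matrix (Fin N) (Fin N) ℝ :=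
  Matrix.of fun i j => if j = i then -(α i)⁻¹ else if j = i + 1 then (α i)⁻¹ else 0

/-- Matrix representation of the μ-Laplacian Δ^μ: `B = -Aᵀ·A`. -/
noncomputable def matB (N : ℕ) [NeZero N] (α : Fin N → ℝ) : Matrix (Fin N) (Fin N) ℝ :=
  -((matA N α)ᵀ * matA N α)

/-- `A` acts as the weighted cyclic forward difference. -/
theorem matA_mulVec_apply {N : ℕ} [NeZero N] (hN : 2 ≤ N) (α v : Fin N → ℝ) (i : Fin N) :
    (matA N α).mulVec v i = (α i)⁻¹ * (v (i + 1) - v i) := by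
  have hne : i + 1 ≠ i := by
    simp
    omega
  have hterm (j : Fin N) : matA N α i j * v j =
      (if j = i then -(α i)⁻¹ * v j else 0) + if j = i + 1 then (α i)⁻¹ * v j else 0 := by
    by_cases h : j = i
    · subst h
      simp [matA, hne.symm]
    · simp [matA, h]
  simp only [mulVec, dotProduct, hterm, Finset.sum_add_distrib, Finset.sum_ite_eq',
    Finset.mem_univ, if_true]
  ring

/-- A function on `Fin N` invariant under the cyclic shift is constant. -/
theorem Fin.apply_eq_apply_zero_of_shift_invariant {N : ℕ} [NeZero N] {β : Type*} {v : Fin N → β}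
    (h : ∀ i, v (i + 1) = v i) (i : Fin N) : v i = v 0 := by
  have hnat (n : ℕ) : v (Fin.ofNat N n) = v 0 := by
    induction n with
    | zero => rfl
    | succ n ih =>
      rw [← ih, ← h (Fin.ofNat N n)]
      congr 1
      ext
      simp [Fin.val_add]
  simpa using hnat i

theorem matA_mulVec_eq_zero_iff {N : ℕ} [NeZero N] (hN : 2 ≤ N) {α : Fin N → ℝ}
    (hα : ∀ i, α i ≠ 0) (v : Fin N → ℝ) :
    (matA N α).mulVec v = 0 ↔ ∃ c : ℝ, v = fun _ => c := by
  constructor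
  · intro h
    refine ⟨v 0, funext (Fin.apply_eq_apply_zero_of_shift_invariant fun i => ?_)⟩
    have hi := congrFun h i
    rw [matA_mulVec_apply hN] at hi
    exact sub_eq_zero.mp ((mul_eq_zero.mp hi).resolve_left (inv_ne_zero (hα i)))
  · rintro ⟨c, rfl⟩
    ext i
    simp [matA_mulVec_apply hN]

/-- The matrix A has rank N − 1; equivalently, the kernel of A is exactly the span of
the all-ones vector. -/
theorem matA_rank (N : ℕ) [NeZero N] (hN : 2 ≤ N) (α : Fin N → ℝ)
    (hα : ∀ i, 0 < α i) :
    (matA N α).rank = N - 1 ∧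
      ∀ v : Fin N → ℝ, (matA N α).mulVec v = 0 ↔ ∃ c : ℝ, v = fun _ => c := by
  have hker := matA_mulVec_eq_zero_iff hN fun i => (hα i).ne'
  refine ⟨?_, hker⟩
  have hspan : LinearMap.ker (matA N α).mulVecLin = Submodule.span ℝ {fun _ => (1 : ℝ)} := by
    ext v
    rw [LinearMap.mem_ker, mulVecLin_apply, hker, Submodule.mem_span_singleton]
    refine exists_congr fun c => ?_
    simp [funext_iff, eq_comm]
  have hone : (fun _ => 1 : Fin N → ℝ) ≠ 0 := fun h => one_ne_zero (congrFun h 0)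
  have hdim := LinearMap.finrank_range_add_finrank_ker (matA N α).mulVecLin
  rw [hspan, finrank_span_singleton hone, Module.finrank_fin_fun] at hdim
  rw [Matrix.rank]
  omega
end

section
/- For the uniform discrete distribution with N even (N ≥ 4), the alternating vector w with entries w j = (−1)^j is an eigenvector of B with eigenvalue −4N², and −4N² = 2·(min over i of B i i); hence the general lower bound 2·minᵢ B i i on eigenvalues of B is attained. -/
open Matrix

/-- Matrix representation of the μ-Laplacian Δ^μ for the uniform discrete probability
distribution with N atoms (αᵢ = 1/N): B i i = −2N², B i j = N² for j ≡ i±1 (mod N),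
all other entries 0. -/
noncomputable def matBU (N : ℕ) [NeZero N] : Matrix (Fin N) (Fin N) ℝ :=
  Matrix.of fun i j =>
    if j = i then -2 * (N : ℝ) ^ 2
    else if j = i + 1 ∨ j = i - 1 then (N : ℝ) ^ 2
    else 0

lemma matBU_mulVec_apply (N : ℕ) [NeZero N] (hN : 3 ≤ N) (v : Fin N → ℝ) (i : Fin N) :
    (matBU N *ᵥ v) i = (N : ℝ) ^ 2 * (v (i + 1) + v (i - 1) - 2 * v i) := by
  have hval : ((1 : Fin N) : ℕ) = 1 := by
    rw [Fin.val_one', Nat.mod_eq_of_lt (by omega)]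
  have h1 : (1 : Fin N) ≠ 0 := fun h => by simp [h] at hval
  have h2 : (1 : Fin N) + 1 ≠ 0 := fun h => by
    have := congrArg Fin.val h
    rw [Fin.val_add, hval, Nat.mod_eq_of_lt (by omega)] at this
    simp at this
  have hp : i + 1 ≠ i := by simpa using h1
  have hm : i - 1 ≠ i := by simpa using h1
  have hpm : i + 1 ≠ i - 1 := fun h => h2 (by
    rw [eq_sub_iff_add_eq, add_assoc] at h
    simpa using h)
  have hterm (j : Fin N) : matBU N i j * v j =
      (if j = i then -2 * (N : ℝ) ^ 2 * v j else 0) +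
        (if j = i + 1 then (N : ℝ) ^ 2 * v j else 0) +
        (if j = i - 1 then (N : ℝ) ^ 2 * v j else 0) := by
    simp only [matBU, Matrix.of_apply]
    by_cases hi : j = i
    · subst hi
      simp [hp.symm, hm.symm]
    · by_cases hi' : j = i + 1
      · subst hi'
        simp [h1, hpm]
      · simp [hi, hi']
  simp only [Matrix.mulVec, dotProduct, hterm, Finset.sum_add_distrib, Finset.sum_ite_eq',
    Finset.mem_univ, if_true]
  ring

lemma neg_one_pow_val_add_one (N : ℕ) [NeZero N] (hNe : Even N) (i : Fin N) :
    (-1 : ℝ) ^ ((i + 1 : Fin N) : ℕ) = -(-1 : ℝ) ^ (i : ℕ) := by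
  have hdvd : 2 ∣ N := hNe.two_dvd
  rw [neg_one_pow_eq_pow_mod_two, Fin.val_add, Fin.val_one', Nat.add_mod_mod,
    Nat.mod_mod_of_dvd _ hdvd, ← neg_one_pow_eq_pow_mod_two, pow_succ, mul_neg_one]

/-- For the uniform discrete distribution with N even, the alternating vector
((−1)^j)ⱼ is an eigenvector of B with eigenvalue −4N², which equals 2·minᵢ B i i;
hence the general lower bound on eigenvalues of B is attained. -/
theorem matBU_alternating_eigen (N : ℕ) [NeZero N] (hN : 4 ≤ N) (hNe : Even N) :
    (fun j : Fin N => ((-1 : ℝ)) ^ (j : ℕ)) ≠ 0 ∧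
      (matBU N).mulVec (fun j : Fin N => ((-1 : ℝ)) ^ (j : ℕ)) =
        (-4 * (N : ℝ) ^ 2) • (fun j : Fin N => ((-1 : ℝ)) ^ (j : ℕ)) ∧
      -4 * (N : ℝ) ^ 2 = 2 * ⨅ i, matBU N i i := by
  refine ⟨fun h => ?_, ?_, ?_⟩
  · simpa using congrFun h 0
  · ext i
    have hs := neg_one_pow_val_add_one N hNe (i - 1)
    rw [sub_add_cancel] at hs
    rw [matBU_mulVec_apply N (by omega), neg_one_pow_val_add_one N hNe i, Pi.smul_apply,
      smul_eq_mul]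
    linear_combination (N : ℝ) ^ 2 * hs
  · simp only [matBU, Matrix.of_apply, if_true, ciInf_const]
    ring
end
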